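/- arXiv:0905.0092 — 2 statements merged into one kernel-verified Lean document; each statement's English description precedes it below -/
import Mathlib

section
/- Let H be a real Hilbert space, φ : H → ℝ a convex differentiable function whose gradient ∇φ is Lipschitz continuous on bounded subsets of H, and A : H → H a maximal monotone operator that is λ-cocoercive for some λ > 0. Let γ > 0 satisfy λγ² > 1, and suppose S := (∇φ + A)⁻¹(0) is nonempty. Then for any initial data u₀, v₀ ∈ H, the unique solution u ∈ C²([0,∞); H) of ü(t) + γ u̇(t) + ∇φ(u(t)) + A(u(t)) = 0 with u(0) = u₀, u̇(0) = v₀ satisfies: u̇ belongs to L²(0,∞; H) (i.e. ∫₀^∞ |u̇(s)|² ds < ∞) and |u̇(t)| → 0 as t → +∞. -/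
open Filter MeasureTheory Set Bornology
open scoped RealInnerProductSpace NNReal Topology

/-- First-order characterization of convexity: a convex function lies above its tangents. -/
theorem ConvexOn.add_inner_gradient_le {H : Type*} [NormedAddCommGroup H] [InnerProductSpace ℝ H]
    [CompleteSpace H] {φ : H → ℝ} (hφ : ConvexOn ℝ univ φ) {x g : H} (hg : HasGradientAt φ g x)
    (y : H) : φ x + ⟪g, y - x⟫ ≤ φ y := by
  have hline : ConvexOn ℝ univ (fun s : ℝ => φ (AffineMap.lineMap x y s)) := by
    exact hφ.comp_affineMap (AffineMap.lineMap x y : ℝ →ᵃ[ℝ] H)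
  have hderiv : HasDerivAt (fun s : ℝ => φ (AffineMap.lineMap x y s)) ⟪g, y - x⟫ 0 := by
    have h0 : HasFDerivAt φ (InnerProductSpace.toDual ℝ H g)
        ((AffineMap.lineMap x y : ℝ →ᵃ[ℝ] H) (0 : ℝ)) := by
      simpa using hg.hasFDerivAt
    exact (h0.comp_hasDerivAt (0 : ℝ) AffineMap.hasDerivAt_lineMap).congr_deriv (by simp)
  have h := hline.le_slope_of_hasDerivAt (mem_univ 0) (mem_univ 1) one_pos hderiv
  simp [slope_def_field] at h
  linarith

/-- A function dominated on `[0,∞)` by the rate of decrease of a nonnegative function is integrable. -/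
theorem integrableOn_Ioi_of_mul_le_neg_deriv {W W' g : ℝ → ℝ} {δ : ℝ} (hδ : 0 < δ)
    (hW : ∀ t ∈ Ici (0 : ℝ), HasDerivWithinAt W (W' t) (Ici 0) t)
    (hW0 : ∀ t ∈ Ici (0 : ℝ), 0 ≤ W t) (hg : ContinuousOn g (Ici 0))
    (hg0 : ∀ t ∈ Ici (0 : ℝ), 0 ≤ g t) (hle : ∀ t ∈ Ici (0 : ℝ), W' t ≤ -(δ * g t)) :
    AntitoneOn W (Ici 0) ∧ IntegrableOn g (Ioi 0) := by
  have hcont : ContinuousOn W (Ici 0) := fun t ht => (hW t ht).continuousWithinAt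
  have hnonpos : ∀ t ∈ Ici (0 : ℝ), W' t ≤ 0 := fun t ht =>
    (hle t ht).trans (neg_nonpos.2 (mul_nonneg hδ.le (hg0 t ht)))
  have hanti : AntitoneOn W (Ici 0) := by
    refine antitoneOn_of_hasDerivWithinAt_nonpos (convex_Ici 0) hcont (f' := W') ?_ ?_
    · intro t ht
      exact (hW t (interior_subset ht)).mono interior_subset
    · intro t ht
      exact hnonpos t (interior_subset ht)
  refine ⟨hanti, ?_⟩
  have hlim : Tendsto W atTop (𝓝 (⨅ t, W (max 0 t))) := by
    have hmono : Antitone fun t => W (max 0 t) := fun s t hst =>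
      hanti (le_max_left 0 s) (le_max_left 0 t) (max_le_max le_rfl hst)
    refine (tendsto_atTop_ciInf hmono ⟨0, ?_⟩).congr' ?_
    · rintro _ ⟨t, rfl⟩
      exact hW0 _ (le_max_left 0 t)
    · filter_upwards [eventually_ge_atTop 0] with t ht
      rw [max_eq_right ht]
  have hint : IntegrableOn W' (Ioi 0) :=
    integrableOn_Ioi_deriv_of_nonpos (hcont 0 self_mem_Ici)
      (fun t ht => (hW t (Ioi_subset_Ici_self ht)).hasDerivAt (Ici_mem_nhds ht))
      (fun t ht => hnonpos t (Ioi_subset_Ici_self ht)) hlim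
  refine Integrable.mono' (hint.neg.const_mul δ⁻¹)
    ((hg.mono Ioi_subset_Ici_self).aestronglyMeasurable measurableSet_Ioi) ?_
  filter_upwards [ae_restrict_mem measurableSet_Ioi] with t ht
  have ht' := Ioi_subset_Ici_self ht
  rw [Real.norm_of_nonneg (hg0 t ht'), Pi.neg_apply, inv_mul_eq_div, le_div_iff₀ hδ]
  linarith [hle t ht']

/-- A bounded nonnegative integrable function with bounded derivative tends to `0` at infinity. -/
theorem tendsto_zero_of_integrableOn_of_deriv_bounded {g g' : ℝ → ℝ} {B M : ℝ}
    (hg : ∀ t ∈ Ici (0 : ℝ), HasDerivWithinAt g (g' t) (Ici 0) t)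
    (hg' : ContinuousOn g' (Ici 0)) (hg0 : ∀ t ∈ Ici (0 : ℝ), 0 ≤ g t)
    (hB : ∀ t ∈ Ici (0 : ℝ), g t ≤ B) (hM : ∀ t ∈ Ici (0 : ℝ), |g' t| ≤ M)
    (hint : IntegrableOn g (Ioi 0)) : Tendsto g atTop (𝓝 0) := by
  have hcont : ContinuousOn g (Ioi 0) := fun t ht =>
    (hg t (Ioi_subset_Ici_self ht)).continuousWithinAt.mono Ioi_subset_Ici_self
  have hcont' : ContinuousOn g' (Ioi 0) := hg'.mono Ioi_subset_Ici_self
  have hsq : Tendsto (fun t => g t ^ 2) atTop (𝓝 0) := by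
    refine tendsto_zero_of_hasDerivAt_of_integrableOn_Ioi (a := 0)
      (f' := fun t => 2 * g t * g' t) ?_ ?_ ?_
    · intro t ht
      exact (((hg t (Ioi_subset_Ici_self ht)).hasDerivAt (Ici_mem_nhds ht)).pow 2).congr_deriv
        (by simp)
    · refine Integrable.mono' (hint.const_mul (2 * M))
        (((hcont.const_mul 2).mul hcont').aestronglyMeasurable measurableSet_Ioi) ?_
      filter_upwards [ae_restrict_mem measurableSet_Ioi] with t ht
      have ht' := Ioi_subset_Ici_self ht
      rw [Real.norm_eq_abs, abs_mul, abs_of_nonneg (mul_nonneg zero_le_two (hg0 t ht'))]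
      nlinarith [mul_le_mul_of_nonneg_left (hM t ht') (hg0 t ht')]
    · refine Integrable.mono' (hint.const_mul B)
        ((hcont.pow 2).aestronglyMeasurable measurableSet_Ioi) ?_
      filter_upwards [ae_restrict_mem measurableSet_Ioi] with t ht
      have ht' := Ioi_subset_Ici_self ht
      rw [Real.norm_of_nonneg (sq_nonneg _)]
      nlinarith [mul_le_mul_of_nonneg_right (hB t ht') (hg0 t ht')]
  have hsqrt := hsq.sqrt
  rw [Real.sqrt_zero] at hsqrt
  refine hsqrt.congr' ?_
  filter_upwards [eventually_ge_atTop 0] with t ht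
  exact Real.sqrt_sq (hg0 t ht)

/-- The quadratic form governing the dissipation is negative definite when `1 < lam * γ ^ 2`. -/
theorem dissipation_le {H : Type*} [NormedAddCommGroup H] [InnerProductSpace ℝ H]
    {lam γ : ℝ} (hlam : 0 < lam) (a v : H) :
    2 * lam * γ * (-γ * ‖v‖ ^ 2 - ⟪a, v⟫) + ‖v‖ ^ 2 - lam * ‖a‖ ^ 2
      ≤ -((lam * γ ^ 2 - 1) * ‖v‖ ^ 2) := by
  have h := norm_add_sq_real a (γ • v)
  rw [inner_smul_right, norm_smul, mul_pow, Real.norm_eq_abs, sq_abs] at h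
  nlinarith [mul_nonneg hlam.le (sq_nonneg ‖a + γ • v‖)]

/-- Coercivity of the Lyapunov function in the velocity and in the distance to the equilibrium. -/
theorem lyapunov_coercive {H : Type*} [NormedAddCommGroup H] [InnerProductSpace ℝ H]
    {lam γ : ℝ} (hcond : 1 < lam * γ ^ 2) (v z : H) :
    ‖v‖ ^ 2 + ‖v + γ • z‖ ^ 2
      ≤ 2 * γ * (lam * γ * ‖v‖ ^ 2 + ⟪v, z⟫ + γ / 2 * ‖z‖ ^ 2) := by
  rw [norm_add_sq_real v (γ • z), inner_smul_right, norm_smul, mul_pow, Real.norm_eq_abs, sq_abs]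
  nlinarith [mul_nonneg (sub_nonneg.2 hcond.le) (sq_nonneg ‖v‖)]

/-- For the system `ü + γu̇ + ∇φ(u) + A(u) = 0` with `λγ² > 1`, the velocity is square integrable on `[0,∞)` and tends to `0` in norm. -/
theorem velocity_L2_and_vanishing
    {H : Type*} [NormedAddCommGroup H] [InnerProductSpace ℝ H] [CompleteSpace H]
    (φ : H → ℝ) (φ' : H → H) (A : H → H) (lam γ : ℝ)
    (hφconv : ConvexOn ℝ univ φ)
    (hφgrad : ∀ x, HasGradientAt φ (φ' x) x)
    (hφlip : ∀ s : Set H, IsBounded s → ∃ K : ℝ≥0, LipschitzOnWith K φ' s)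
    (hAmono : ∀ v w : H, 0 ≤ ⟪A v - A w, v - w⟫)
    (hAmax : ∀ x y : H, (∀ v : H, 0 ≤ ⟪A v - y, v - x⟫) → y = A x)
    (hlam : 0 < lam)
    (hAcoco : ∀ v w : H, lam * ‖A v - A w‖ ^ 2 ≤ ⟪A v - A w, v - w⟫)
    (hγ : 0 < γ) (hcond : 1 < lam * γ ^ 2)
    (S : Set H) (hS : S = {v : H | φ' v + A v = 0}) (hSne : S.Nonempty)
    (u₀ v₀ : H) (u u' u'' : ℝ → H)
    (hu0 : u 0 = u₀) (hv0 : u' 0 = v₀)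
    (hu : ∀ t ∈ Ici (0:ℝ), HasDerivWithinAt u (u' t) (Ici 0) t)
    (hu' : ∀ t ∈ Ici (0:ℝ), HasDerivWithinAt u' (u'' t) (Ici 0) t)
    (hu''cont : ContinuousOn u'' (Ici 0))
    (heq : ∀ t ∈ Ici (0:ℝ), u'' t + γ • u' t + φ' (u t) + A (u t) = 0) :
    IntegrableOn (fun s => ‖u' s‖ ^ 2) (Ici 0) ∧ Tendsto (fun t => ‖u' t‖) atTop (𝓝 0) := by
  obtain ⟨p, hp⟩ := hSne
  replace hp : φ' p + A p = 0 := by simpa [hS] using hp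
  let W : ℝ → ℝ := fun t =>
    2 * lam * γ * (1 / 2 * ‖u' t‖ ^ 2 + (φ (u t) - φ p - ⟪φ' p, u t - p⟫))
      + ⟪u' t, u t - p⟫ + γ / 2 * ‖u t - p‖ ^ 2
  let W' : ℝ → ℝ := fun t =>
    2 * lam * γ * (⟪u' t, u'' t⟫ + (⟪φ' (u t), u' t⟫ - ⟪φ' p, u' t⟫))
      + (⟪u' t, u' t⟫ + ⟪u'' t, u t - p⟫) + γ * ⟪u t - p, u' t⟫
  have hcontu : ContinuousOn u (Ici 0) := fun t ht => (hu t ht).continuousWithinAt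
  have hcontu' : ContinuousOn u' (Ici 0) := fun t ht => (hu' t ht).continuousWithinAt
  have hbregman (x : H) : 0 ≤ φ x - φ p - ⟪φ' p, x - p⟫ := by
    linarith [hφconv.add_inner_gradient_le (hφgrad p) x]
  have hgradmono (x : H) : 0 ≤ ⟪φ' x - φ' p, x - p⟫ := by
    have h1 := hφconv.add_inner_gradient_le (hφgrad p) x
    have h2 := hφconv.add_inner_gradient_le (hφgrad x) p
    rw [← neg_sub x p, inner_neg_right] at h2
    rw [inner_sub_left]
    linarith
  have hacc (t : ℝ) (ht : t ∈ Ici (0 : ℝ)) :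
      u'' t = -(γ • u' t) - (φ' (u t) - φ' p) - (A (u t) - A p) := by
    have h : u'' t + γ • u' t + φ' (u t) + A (u t) = φ' p + A p := (heq t ht).trans hp.symm
    rw [← sub_eq_zero] at h ⊢
    rw [← h]
    abel
  have hW : ∀ t ∈ Ici (0 : ℝ), HasDerivWithinAt W (W' t) (Ici 0) t := by
    intro t ht
    have hz := (hu t ht).sub_const p
    have hφu : HasDerivWithinAt (fun s => φ (u s)) ⟪φ' (u t), u' t⟫ (Ici 0) t := by
      exact ((hφgrad (u t)).hasFDerivAt.comp_hasDerivWithinAt t (hu t ht)).congr_deriv (by simp)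
    have hin : HasDerivWithinAt (fun s => ⟪φ' p, u s - p⟫) ⟪φ' p, u' t⟫ (Ici 0) t := by
      simpa using (hasDerivWithinAt_const t (Ici 0) (φ' p)).inner ℝ hz
    have h := (((((hu' t ht).norm_sq.const_mul (1 / 2)).add
      ((hφu.sub_const (φ p)).sub hin)).const_mul (2 * lam * γ)).add
        ((hu' t ht).inner ℝ hz)).add (hz.norm_sq.const_mul (γ / 2))
    refine h.congr_deriv ?_
    simp only [W']
    ring
  have hWlower (t : ℝ) : ‖u' t‖ ^ 2 + ‖u' t + γ • (u t - p)‖ ^ 2 ≤ 2 * γ * W t := by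
    refine (lyapunov_coercive hcond (u' t) (u t - p)).trans ?_
    refine mul_le_mul_of_nonneg_left ?_ (by positivity)
    have h : 0 ≤ 2 * lam * γ * (φ (u t) - φ p - ⟪φ' p, u t - p⟫) :=
      mul_nonneg (by positivity) (hbregman _)
    simp only [W]
    linarith
  have hW0 : ∀ t ∈ Ici (0 : ℝ), 0 ≤ W t := fun t _ =>
    nonneg_of_mul_nonneg_right ((by positivity : (0 : ℝ) ≤ _).trans (hWlower t))
      (by positivity)
  have hdiss : ∀ t ∈ Ici (0 : ℝ), W' t ≤ -((lam * γ ^ 2 - 1) * ‖u' t‖ ^ 2) := by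
    intro t ht
    refine le_trans ?_ (dissipation_le (γ := γ) hlam (A (u t) - A p) (u' t))
    have h1 := hAcoco (u t) p
    have h2 := hgradmono (u t)
    have e1 : ⟪u' t, u'' t⟫ = -γ * ‖u' t‖ ^ 2 - (⟪φ' (u t), u' t⟫ - ⟪φ' p, u' t⟫)
        - ⟪A (u t) - A p, u' t⟫ := by
      rw [hacc t ht, inner_sub_right, inner_sub_right, inner_neg_right, inner_smul_right,
        real_inner_self_eq_norm_sq, real_inner_comm _ (u' t), real_inner_comm _ (u' t),
        inner_sub_left (φ' _)]
      ring
    have e2 : ⟪u'' t, u t - p⟫ = -γ * ⟪u t - p, u' t⟫ - ⟪φ' (u t) - φ' p, u t - p⟫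
        - ⟪A (u t) - A p, u t - p⟫ := by
      rw [hacc t ht, inner_sub_left, inner_sub_left, inner_neg_left, real_inner_smul_left,
        real_inner_comm (u t - p) (u' t)]
      ring
    simp only [W']
    rw [e1, e2, real_inner_self_eq_norm_sq]
    linarith
  obtain ⟨hanti, hint⟩ := integrableOn_Ioi_of_mul_le_neg_deriv (sub_pos.2 hcond) hW hW0
    (hcontu'.norm.pow 2) (fun t _ => sq_nonneg _) hdiss
  refine ⟨(integrableOn_Ici_iff_integrableOn_Ioi).2 hint, ?_⟩
  set C : ℝ := 2 * γ * W 0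
  have hWC : ∀ t ∈ Ici (0 : ℝ), 2 * γ * W t ≤ C := fun t ht =>
    mul_le_mul_of_nonneg_left (hanti self_mem_Ici ht ht) (by positivity)
  have hvC : ∀ t ∈ Ici (0 : ℝ), ‖u' t‖ ^ 2 ≤ C := fun t ht => by
    linarith [hWlower t, hWC t ht, sq_nonneg ‖u' t + γ • (u t - p)‖]
  have hv : ∀ t ∈ Ici (0 : ℝ), ‖u' t‖ ≤ √C := fun t ht => Real.le_sqrt_of_sq_le (hvC t ht)
  have hz : ∀ t ∈ Ici (0 : ℝ), ‖u t - p‖ ≤ 2 * √C / γ := by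
    intro t ht
    have h1 : ‖u' t + γ • (u t - p)‖ ≤ √C := Real.le_sqrt_of_sq_le (by
      linarith [hWlower t, hWC t ht, sq_nonneg ‖u' t‖])
    have h2 := norm_sub_le (u' t + γ • (u t - p)) (u' t)
    rw [add_sub_cancel_left, norm_smul, Real.norm_of_nonneg hγ.le] at h2
    rw [le_div_iff₀ hγ]
    linarith [hv t ht]
  set R : ℝ := 2 * √C / γ
  have hR : 0 ≤ R := by positivity
  obtain ⟨K, hK⟩ := hφlip (Metric.closedBall p R) Metric.isBounded_closedBall
  have hacc_le : ∀ t ∈ Ici (0 : ℝ), ‖u'' t‖ ≤ γ * √C + K * R + R / lam := by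
    intro t ht
    have h1 : ‖φ' (u t) - φ' p‖ ≤ K * R := by
      refine (hK.norm_sub_le ?_ (Metric.mem_closedBall_self hR)).trans
        (mul_le_mul_of_nonneg_left (hz t ht) K.coe_nonneg)
      rw [Metric.mem_closedBall, dist_eq_norm]
      exact hz t ht
    have h2 : ‖A (u t) - A p‖ ≤ R / lam := by
      rw [le_div_iff₀ hlam]
      refine le_trans ?_ (hz t ht)
      have h := (hAcoco (u t) p).trans (real_inner_le_norm _ _)
      rcases (norm_nonneg (A (u t) - A p)).eq_or_lt with h0 | h0
      · rw [← h0, zero_mul]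
        exact norm_nonneg _
      · refine le_of_mul_le_mul_left ?_ h0
        linarith
    have h3 : ‖-(γ • u' t)‖ ≤ γ * √C := by
      rw [norm_neg, norm_smul, Real.norm_of_nonneg hγ.le]
      exact mul_le_mul_of_nonneg_left (hv t ht) hγ.le
    rw [hacc t ht]
    exact (norm_sub_le _ _).trans (add_le_add ((norm_sub_le _ _).trans (add_le_add h3 h1)) h2)
  have hsq : Tendsto (fun t => ‖u' t‖ ^ 2) atTop (𝓝 0) := by
    refine tendsto_zero_of_integrableOn_of_deriv_bounded (g' := fun t => 2 * ⟪u' t, u'' t⟫)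
      (M := 2 * (√C * (γ * √C + K * R + R / lam)))
      (fun t ht => (hu' t ht).norm_sq) ((hcontu'.inner hu''cont).const_mul 2)
      (fun t _ => sq_nonneg _) hvC ?_ hint
    intro t ht
    rw [abs_mul, abs_two]
    refine mul_le_mul_of_nonneg_left ((abs_real_inner_le_norm _ _).trans ?_) zero_le_two
    exact mul_le_mul (hv t ht) (hacc_le t ht) (norm_nonneg _) (Real.sqrt_nonneg _)
  simpa using hsq.sqrt
end

section
/- Let H be a real Hilbert space, T : H → H a contraction (1-Lipschitz map), and γ > √2. Suppose Fix T := {v ∈ H : Tv = v} is nonempty. Then for any initial data u₀, v₀ ∈ H, the unique solution u ∈ C²([0,∞); H) of ü(t) + γ u̇(t) + u(t) − T(u(t)) = 0 with u(0) = u₀, u̇(0) = v₀ satisfies: (i) there exists u_∞ ∈ Fix T such that u(t) converges weakly to u_∞ as t → +∞; (ii) ∫₀^∞ |u̇(s)|² ds < ∞ and lim_{t→+∞} |u̇(t)| = lim_{t→+∞} |ü(t)| = 0. -/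
open Filter MeasureTheory Set
open scoped Topology
open scoped InnerProductSpace

section RealAnalysis

/-- A nonnegative function on `[0, ∞)` with nonpositive derivative is antitone and converges at
infinity. -/
lemma exists_tendsto_of_hasDerivWithinAt_nonpos {E E' : ℝ → ℝ}
    (hE : ∀ t ∈ Ici (0 : ℝ), HasDerivWithinAt E (E' t) (Ici 0) t)
    (hE' : ∀ t ∈ Ici (0 : ℝ), E' t ≤ 0) (hpos : ∀ t ∈ Ici (0 : ℝ), 0 ≤ E t) :
    AntitoneOn E (Ici 0) ∧ ∃ l, Tendsto E atTop (𝓝 l) := by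
  have hanti : AntitoneOn E (Ici 0) := by
    have hd : ∀ t ∈ interior (Ici (0 : ℝ)), HasDerivAt E (E' t) t := fun t ht =>
      (hE t (interior_subset ht)).hasDerivAt (mem_interior_iff_mem_nhds.1 ht)
    refine antitoneOn_of_deriv_nonpos (convex_Ici 0) (fun t ht => (hE t ht).continuousWithinAt)
      (fun t ht => (hd t ht).differentiableAt.differentiableWithinAt) fun t ht => ?_
    rw [(hd t ht).deriv]
    exact hE' t (interior_subset ht)
  refine ⟨hanti, _, (tendsto_atTop_ciInf (f := fun t => E (max t 0)) (fun s t hst => ?_)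
    ⟨0, ?_⟩).congr' ?_⟩
  · exact hanti (mem_Ici.2 (le_max_right _ _)) (mem_Ici.2 (le_max_right _ _)) (max_le_max_right 0 hst)
  · rintro _ ⟨t, rfl⟩
    exact hpos _ (mem_Ici.2 (le_max_right _ _))
  · filter_upwards [eventually_ge_atTop 0] with t ht
    rw [max_eq_left ht]

/-- If `f` tends to `0` at infinity and its derivative is Lipschitz on `[0, ∞)`, then the derivative
tends to `0` as well. -/
lemma tendsto_deriv_zero_of_lipschitz {F : Type*} [NormedAddCommGroup F] [NormedSpace ℝ F]
    {f f' : ℝ → F} {C : ℝ}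
    (hf : ∀ t ∈ Ici (0 : ℝ), HasDerivWithinAt f (f' t) (Ici 0) t)
    (hlip : ∀ s ∈ Ici (0 : ℝ), ∀ t ∈ Ici (0 : ℝ), ‖f' s - f' t‖ ≤ C * |s - t|)
    (hlim : Tendsto f atTop (𝓝 0)) : Tendsto f' atTop (𝓝 0) := by
  have hC : 0 ≤ C := by
    simpa using (norm_nonneg _).trans (hlip 1 (mem_Ici.2 zero_le_one) 0 self_mem_Ici)
  have key : ∀ h > 0, ∀ t ∈ Ici (0 : ℝ), ‖f' t‖ ≤ ‖f (t + h) - f t‖ / h + C * h := by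
    intro h hh t ht
    have ht0 : 0 ≤ t := ht
    have hsub : Icc t (t + h) ⊆ Ici 0 := fun s hs => ht0.trans hs.1
    have hd : ∀ s ∈ Icc t (t + h), HasDerivWithinAt (fun s => f s - (s - t) • f' t)
        (f' s - (1 : ℝ) • f' t) (Icc t (t + h)) s := fun s hs =>
      ((hf s (hsub hs)).mono hsub).sub
        (((hasDerivWithinAt_id s _).sub_const t).smul_const (f' t))
    have hb : ∀ s ∈ Icc t (t + h), ‖f' s - (1 : ℝ) • f' t‖ ≤ C * h := fun s hs => by
      rw [one_smul]
      refine (hlip s (hsub hs) t ht).trans (mul_le_mul_of_nonneg_left ?_ hC)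
      rw [abs_of_nonneg (sub_nonneg.2 hs.1)]
      linarith [hs.2]
    have hmv := (convex_Icc t (t + h)).norm_image_sub_le_of_norm_hasDerivWithin_le hd hb
      (left_mem_Icc.2 (by linarith)) (right_mem_Icc.2 (by linarith))
    simp only [sub_self, zero_smul, sub_zero, add_sub_cancel_left, Real.norm_eq_abs,
      abs_of_pos hh] at hmv
    have htri : ‖h • f' t‖ ≤ ‖f (t + h) - f t‖ + C * h * h := by
      have : h • f' t = (f (t + h) - f t) - (f (t + h) - h • f' t - f t) := by abel
      rw [this]
      exact (norm_sub_le _ _).trans (by linarith)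
    rw [norm_smul, Real.norm_eq_abs, abs_of_pos hh] at htri
    rw [div_add' _ _ _ hh.ne', le_div_iff₀ hh]
    linarith
  rw [tendsto_zero_iff_norm_tendsto_zero, Metric.tendsto_nhds]
  intro ε hε
  obtain ⟨h, hh, hCh⟩ : ∃ h > 0, C * h < ε / 2 := by
    refine ⟨ε / (2 * (C + 1)), by positivity, ?_⟩
    rw [mul_div_assoc', div_lt_div_iff₀ (by positivity) two_pos]
    nlinarith
  have hdiff : Tendsto (fun t => ‖f (t + h) - f t‖ / h) atTop (𝓝 0) := by
    simpa using (((hlim.comp (tendsto_atTop_add_const_right _ h tendsto_id)).sub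
      hlim).norm.div_const h)
  filter_upwards [hdiff.eventually_lt_const (half_pos hε), eventually_ge_atTop 0] with t ht ht0
  rw [Real.dist_eq, sub_zero, abs_norm]
  linarith [key h hh t ht0]

end RealAnalysis

section WeakConvergence

variable {H : Type*} [NormedAddCommGroup H] [InnerProductSpace ℝ H]

/-- **Demiclosedness principle** for contractions. -/
lemma apply_eq_self_of_weak_limit {α : Type*} {l : Filter α} [l.NeBot] {T : H → H}
    (hT : ∀ x y : H, ‖T x - T y‖ ≤ ‖x - y‖) {u : α → H} {w : H} {M : ℝ}
    (hM : ∀ᶠ i in l, ‖u i‖ ≤ M)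
    (hweak : ∀ x, Tendsto (fun i => ⟪u i, x⟫_ℝ) l (𝓝 ⟪w, x⟫_ℝ))
    (hres : Tendsto (fun i => ‖u i - T (u i)‖) l (𝓝 0)) : T w = w := by
  have hbound : ∀ᶠ i in l, ‖w - T w‖ ^ 2 ≤ ‖u i - T (u i)‖ ^ 2
      + 2 * (M + ‖w‖) * ‖u i - T (u i)‖ - 2 * (⟪u i, w - T w⟫_ℝ - ⟪w, w - T w⟫_ℝ) := by
    filter_upwards [hM] with i hi
    have h1 : ‖u i - T w‖ ≤ ‖u i - T (u i)‖ + ‖u i - w‖ := by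
      have := norm_add_le (u i - T (u i)) (T (u i) - T w)
      rw [sub_add_sub_cancel] at this
      linarith [hT (u i) w]
    have h2 : ‖u i - w‖ ≤ M + ‖w‖ := (norm_sub_le _ _).trans (by linarith)
    have h3 : ‖u i - T w‖ ^ 2
        = ‖u i - w‖ ^ 2 + 2 * ⟪u i - w, w - T w⟫_ℝ + ‖w - T w‖ ^ 2 := by
      rw [← norm_add_sq_real, sub_add_sub_cancel]
    rw [inner_sub_left] at h3
    have h4 := pow_le_pow_left₀ (norm_nonneg _) h1 2
    nlinarith [mul_le_mul_of_nonneg_left h2 (norm_nonneg (u i - T (u i)))]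
  have hlim : Tendsto (fun i => ‖u i - T (u i)‖ ^ 2 + 2 * (M + ‖w‖) * ‖u i - T (u i)‖
      - 2 * (⟪u i, w - T w⟫_ℝ - ⟪w, w - T w⟫_ℝ)) l (𝓝 0) := by
    simpa using ((hres.pow 2).add (hres.const_mul (2 * (M + ‖w‖)))).sub
      (((hweak (w - T w)).sub_const ⟪w, w - T w⟫_ℝ).const_mul 2)
  have hle : ‖w - T w‖ ^ 2 ≤ 0 := ge_of_tendsto hlim hbound
  have h0 : w - T w = 0 := by
    rw [← norm_eq_zero]
    exact pow_eq_zero_iff two_ne_zero |>.1 (le_antisymm hle (sq_nonneg _))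
  exact (sub_eq_zero.1 h0).symm

/-- **Opial's lemma**: a bounded family all of whose weak cluster points lie in a set `S`, and whose
distance to each point of `S` converges, converges weakly to a point of `S`. -/
lemma exists_weak_limit_of_opial [CompleteSpace H] {α : Type*} {l : Filter α} [l.NeBot]
    {S : Set H} {u : α → H} {M : ℝ} (hM : ∀ᶠ i in l, ‖u i‖ ≤ M)
    (hdist : ∀ v ∈ S, ∃ d, Tendsto (fun i => ‖u i - v‖ ^ 2) l (𝓝 d))
    (hcluster : ∀ (U : Ultrafilter α) (w : H), (U : Filter α) ≤ l →
      (∀ x, Tendsto (fun i => ⟪u i, x⟫_ℝ) U (𝓝 ⟪w, x⟫_ℝ)) → w ∈ S) :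
    ∃ w ∈ S, ∀ f : H →L[ℝ] ℝ, Tendsto (fun i => f (u i)) l (𝓝 (f w)) := by
  let D := InnerProductSpace.toDual ℝ H
  let φ : α → WeakDual ℝ H := fun i => StrongDual.toWeakDual (D (u i))
  let K : Set (WeakDual ℝ H) := WeakDual.toStrongDual ⁻¹' Metric.closedBall 0 M
  have hK : IsCompact K := WeakDual.isCompact_closedBall 0 M
  have hmem : ∀ᶠ i in l, φ i ∈ K := by
    filter_upwards [hM] with i hi
    change D (u i) ∈ Metric.closedBall 0 M
    rwa [mem_closedBall_zero_iff, LinearIsometryEquiv.norm_map]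
  have hweak : ∀ {y : WeakDual ℝ H} {F : Filter α}, Tendsto φ F (𝓝 y) ↔
      ∀ x, Tendsto (fun i => ⟪u i, x⟫_ℝ) F (𝓝 ⟪D.symm (WeakDual.toStrongDual y), x⟫_ℝ) := by
    intro y F
    rw [tendsto_iff_forall_eval_tendsto_topDualPairing]
    refine forall_congr' fun x => ?_
    rw [InnerProductSpace.toDual_symm_apply]
    rfl
  have huniq : ∀ y z : WeakDual ℝ H, MapClusterPt y l φ → MapClusterPt z l φ → y = z := by
    intro y z hy hz
    obtain ⟨U, hU, hUy⟩ := mapClusterPt_iff_ultrafilter.1 hy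
    obtain ⟨V, hV, hVz⟩ := mapClusterPt_iff_ultrafilter.1 hz
    rw [hweak] at hUy hVz
    set p := D.symm (WeakDual.toStrongDual y) with hp
    set q := D.symm (WeakDual.toStrongDual z) with hq
    obtain ⟨a, ha⟩ := hdist p (hcluster U p hU hUy)
    obtain ⟨b, hb⟩ := hdist q (hcluster V q hV hVz)
    have hpq : Tendsto (fun i => ⟪u i, p - q⟫_ℝ) l
        (𝓝 ((‖p‖ ^ 2 - ‖q‖ ^ 2 - (a - b)) / 2)) := by
      refine (((ha.sub hb).const_sub (‖p‖ ^ 2 - ‖q‖ ^ 2)).div_const 2).congr fun i => ?_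
      rw [norm_sub_sq_real, norm_sub_sq_real, inner_sub_right]
      ring
    have hpe := tendsto_nhds_unique (hUy (p - q)) (hpq.mono_left hU)
    have hqe := tendsto_nhds_unique (hVz (p - q)) (hpq.mono_left hV)
    have h0 : ⟪p - q, p - q⟫_ℝ = 0 := by
      rw [inner_sub_left, hpe, hqe, sub_self]
    have hpq' : p = q := sub_eq_zero.1 (inner_self_eq_zero.1 h0)
    exact WeakDual.toStrongDual.injective (D.symm.injective hpq')
  obtain ⟨y, -, hy⟩ := hK.exists_mapClusterPt_of_frequently hmem.frequently
  have hlim : Tendsto φ l (𝓝 y) :=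
    hK.le_nhds_of_unique_clusterPt hmem fun z _ hz => huniq z y hz hy
  rw [hweak] at hlim
  obtain ⟨U, hU⟩ := Ultrafilter.exists_le l
  refine ⟨_, hcluster U _ hU fun x => (hlim x).mono_left hU, fun f => ?_⟩
  have hf : ∀ x, f x = ⟪x, D.symm f⟫_ℝ := fun x => by
    rw [real_inner_comm, InnerProductSpace.toDual_symm_apply]
  simpa only [hf] using hlim (D.symm f)

end WeakConvergence

section Dynamics

variable {H : Type*} [NormedAddCommGroup H] [InnerProductSpace ℝ H]

/-- The displacement `x - T x` of a contraction is cocoercive with respect to a fixed point. -/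
lemma norm_sub_apply_sq_le {T : H → H} (hT : ∀ x y : H, ‖T x - T y‖ ≤ ‖x - y‖) {v : H}
    (hv : T v = v) (x : H) : ‖x - T x‖ ^ 2 ≤ 2 * ⟪x - v, x - T x⟫_ℝ := by
  have h := pow_le_pow_left₀ (norm_nonneg _) (hT x v) 2
  have e : T x - T v = (x - v) - (x - T x) := by rw [hv]; abel
  rw [e, norm_sub_sq_real (x - v)] at h
  linarith

/-- The Lyapunov function of the damped dynamics, with reference point `v`. -/
noncomputable def dampedEnergy (γ : ℝ) (v x y : H) : ℝ :=
  ⟪x - v, y⟫_ℝ + γ / 2 * ‖x - v‖ ^ 2 + γ / 2 * ‖y‖ ^ 2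

lemma le_dampedEnergy (γ : ℝ) (v x y : H) :
    (γ - 1) / 2 * (‖x - v‖ ^ 2 + ‖y‖ ^ 2) ≤ dampedEnergy γ v x y := by
  have h := norm_add_sq_real (x - v) y
  unfold dampedEnergy
  nlinarith [sq_nonneg ‖x - v + y‖]

variable {T : H → H} {γ : ℝ} {u u' u'' : ℝ → H}

lemma exists_hasDerivWithinAt_dampedEnergy (hT : ∀ x y : H, ‖T x - T y‖ ≤ ‖x - y‖)
    {v : H} (hv : T v = v)
    (hu : ∀ t ∈ Ici (0 : ℝ), HasDerivWithinAt u (u' t) (Ici 0) t)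
    (hu' : ∀ t ∈ Ici (0 : ℝ), HasDerivWithinAt u' (u'' t) (Ici 0) t)
    (heq : ∀ t ∈ Ici (0 : ℝ), u'' t + γ • u' t + u t - T (u t) = 0) :
    ∃ E' : ℝ → ℝ, (∀ t ∈ Ici (0 : ℝ),
      HasDerivWithinAt (fun t => dampedEnergy γ v (u t) (u' t)) (E' t) (Ici 0) t) ∧
      ∀ t ∈ Ici (0 : ℝ),
        E' t + (γ ^ 2 / 2 - 1) * ‖u' t‖ ^ 2 + ‖u'' t‖ ^ 2 / 2 ≤ 0 := by
  refine ⟨fun t => ⟪u t - v, u'' t⟫_ℝ + ⟪u' t, u' t⟫_ℝ + γ / 2 * (2 * ⟪u t - v, u' t⟫_ℝ)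
    + γ / 2 * (2 * ⟪u' t, u'' t⟫_ℝ), fun t ht => ?_, fun t ht => ?_⟩
  · have hd := (hu t ht).sub_const v
    exact ((hd.inner ℝ (hu' t ht)).add (hd.norm_sq.const_mul _)).add
      ((hu' t ht).norm_sq.const_mul _)
  · have e : u t - T (u t) = -(u'' t + γ • u' t) := by
      rw [eq_neg_iff_add_eq_zero, ← heq t ht]
      abel
    have h := norm_sub_apply_sq_le hT hv (u t)
    rw [e, norm_neg, norm_add_sq_real, inner_neg_right, inner_add_right, inner_smul_right,
      inner_smul_right, norm_smul, mul_pow, Real.norm_eq_abs, sq_abs,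
      real_inner_comm (u' t)] at h
    simp only [real_inner_self_eq_norm_sq]
    linarith

end Dynamics

/-- For a contraction `T : H → H` with a fixed point and `γ > √2`, every
trajectory of `ü + γu̇ + u − T(u) = 0` converges weakly to a fixed point of `T`; the velocity is
square integrable and both the velocity and the acceleration tend to `0` in norm. -/
theorem second_order_fixed_point_dynamics
    {H : Type*} [NormedAddCommGroup H] [InnerProductSpace ℝ H] [CompleteSpace H]
    (T : H → H) (γ : ℝ)
    (hT : ∀ x y : H, ‖T x - T y‖ ≤ ‖x - y‖)
    (hγ : Real.sqrt 2 < γ)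
    (hfix : {v : H | T v = v}.Nonempty)
    (u₀ v₀ : H) (u u' u'' : ℝ → H)
    (hu0 : u 0 = u₀) (hv0 : u' 0 = v₀)
    (hu : ∀ t ∈ Ici (0:ℝ), HasDerivWithinAt u (u' t) (Ici 0) t)
    (hu' : ∀ t ∈ Ici (0:ℝ), HasDerivWithinAt u' (u'' t) (Ici 0) t)
    (hu''cont : ContinuousOn u'' (Ici 0))
    (heq : ∀ t ∈ Ici (0:ℝ), u'' t + γ • u' t + u t - T (u t) = 0) :
    (∃ uinf ∈ {v : H | T v = v},
      ∀ f : H →L[ℝ] ℝ, Tendsto (fun t => f (u t)) atTop (𝓝 (f uinf))) ∧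
    IntegrableOn (fun s => ‖u' s‖ ^ 2) (Ici 0) ∧
    Tendsto (fun t => ‖u' t‖) atTop (𝓝 0) ∧
    Tendsto (fun t => ‖u'' t‖) atTop (𝓝 0) := by
  have hγ2 : 2 < γ ^ 2 := (Real.sqrt_lt' ((Real.sqrt_nonneg 2).trans_lt hγ)).1 hγ
  have hγ1 : 1 < γ := by nlinarith [(Real.sqrt_nonneg 2).trans_lt hγ]
  have hlyap : ∀ v, T v = v →
      (∀ t ∈ Ici (0 : ℝ), dampedEnergy γ v (u t) (u' t) ≤ dampedEnergy γ v (u 0) (u' 0)) ∧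
      (∃ d, Tendsto (fun t => dampedEnergy γ v (u t) (u' t)) atTop (𝓝 d)) ∧
      ∃ E' : ℝ → ℝ, IntegrableOn E' (Ioi 0) ∧ ∀ t ∈ Ici (0 : ℝ),
        E' t + (γ ^ 2 / 2 - 1) * ‖u' t‖ ^ 2 + ‖u'' t‖ ^ 2 / 2 ≤ 0 := by
    intro v hv
    obtain ⟨E', hE, hE'⟩ := exists_hasDerivWithinAt_dampedEnergy hT hv hu hu' heq
    have hneg : ∀ t ∈ Ici (0 : ℝ), E' t ≤ 0 := fun t ht => by
      nlinarith [hE' t ht, mul_nonneg (by linarith : 0 ≤ γ ^ 2 / 2 - 1) (sq_nonneg ‖u' t‖),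
        sq_nonneg ‖u'' t‖]
    obtain ⟨hanti, d, hd⟩ := exists_tendsto_of_hasDerivWithinAt_nonpos hE hneg fun t _ =>
      (mul_nonneg (by linarith) (by positivity)).trans (le_dampedEnergy γ v (u t) (u' t))
    exact ⟨fun t ht => hanti self_mem_Ici ht ht, ⟨d, hd⟩, E',
      integrableOn_Ioi_deriv_of_nonpos (hE 0 self_mem_Ici).continuousWithinAt
        (fun t ht => (hE t (mem_Ici_of_Ioi ht)).hasDerivAt (Ici_mem_nhds ht))
        (fun t ht => hneg t (mem_Ici_of_Ioi ht)) hd, hE'⟩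
  obtain ⟨v, hv : T v = v⟩ := hfix
  obtain ⟨hEle, -, E', hE'int, hE'⟩ := hlyap v hv
  obtain ⟨R, hR⟩ : ∃ R : ℝ, ∀ t ∈ Ici (0 : ℝ), ‖u t - v‖ ≤ R ∧ ‖u' t‖ ≤ R := by
    refine ⟨√(dampedEnergy γ v (u 0) (u' 0) / ((γ - 1) / 2)), fun t ht => ?_⟩
    have h : ‖u t - v‖ ^ 2 + ‖u' t‖ ^ 2 ≤
        dampedEnergy γ v (u 0) (u' 0) / ((γ - 1) / 2) := by
      rw [le_div_iff₀' (by linarith)]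
      exact (le_dampedEnergy γ v (u t) (u' t)).trans (hEle t ht)
    constructor <;> apply Real.le_sqrt_of_sq_le <;>
      linarith [sq_nonneg ‖u t - v‖, sq_nonneg ‖u' t‖]
  have hu''eq : ∀ t ∈ Ici (0 : ℝ), u'' t = T (u t) - u t - γ • u' t := fun t ht => by
    rw [← sub_eq_zero, ← heq t ht]
    abel
  have hTu : ∀ t ∈ Ici (0 : ℝ), ‖T (u t) - u t‖ ≤ 2 * R := fun t ht => by
    have := norm_sub_le (T (u t) - T v) (u t - v)
    rw [hv, sub_sub_sub_cancel_right] at this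
    have h2 := hT (u t) v
    rw [hv] at h2
    linarith [(hR t ht).1]
  have hu''R : ∀ t ∈ Ici (0 : ℝ), ‖u'' t‖ ≤ 2 * R + γ * R := fun t ht => by
    rw [hu''eq t ht]
    refine (norm_sub_le _ _).trans (add_le_add (hTu t ht) ?_)
    rw [norm_smul, Real.norm_eq_abs, abs_of_pos (by linarith)]
    exact mul_le_mul_of_nonneg_left (hR t ht).2 (by linarith)
  have hlip : ∀ s ∈ Ici (0 : ℝ), ∀ t ∈ Ici (0 : ℝ),
      ‖u'' s - u'' t‖ ≤ (2 * R + γ * (2 * R + γ * R)) * |s - t| := by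
    intro s hs t ht
    have h1 : ‖u s - u t‖ ≤ R * |s - t| :=
      (convex_Ici 0).norm_image_sub_le_of_norm_hasDerivWithin_le hu (fun t ht => (hR t ht).2) ht hs
    have h2 : ‖u' s - u' t‖ ≤ (2 * R + γ * R) * |s - t| :=
      (convex_Ici 0).norm_image_sub_le_of_norm_hasDerivWithin_le hu' hu''R ht hs
    have e : u'' s - u'' t = (T (u s) - T (u t)) - (u s - u t) - γ • (u' s - u' t) := by
      rw [hu''eq s hs, hu''eq t ht, smul_sub]
      abel
    have h3 : ‖γ • (u' s - u' t)‖ ≤ γ * ((2 * R + γ * R) * |s - t|) := by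
      rw [norm_smul, Real.norm_eq_abs, abs_of_pos (by linarith)]
      exact mul_le_mul_of_nonneg_left h2 (by linarith)
    rw [e]
    linarith [norm_sub_le ((T (u s) - T (u t)) - (u s - u t)) (γ • (u' s - u' t)),
      norm_sub_le (T (u s) - T (u t)) (u s - u t), hT (u s) (u t)]
  have hu'cont : ContinuousOn u' (Ici 0) := fun t ht => (hu' t ht).continuousWithinAt
  have hint' : IntegrableOn (fun s => ‖u' s‖ ^ 2) (Ioi 0) := by
    refine (hE'int.const_mul (-(γ ^ 2 / 2 - 1)⁻¹)).mono'
      (((hu'cont.mono Ioi_subset_Ici_self).norm.pow 2).aestronglyMeasurable measurableSet_Ioi)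
      (ae_restrict_of_forall_mem measurableSet_Ioi fun t ht => ?_)
    rw [Real.norm_of_nonneg (sq_nonneg _), neg_mul, ← mul_neg, inv_mul_eq_div,
      le_div_iff₀' (by linarith)]
    linarith [hE' t (mem_Ici_of_Ioi ht), sq_nonneg ‖u'' t‖]
  have hint'' : IntegrableOn (fun s => ‖u'' s‖ ^ 2) (Ioi 0) := by
    refine (hE'int.const_mul (-2)).mono'
      (((hu''cont.mono Ioi_subset_Ici_self).norm.pow 2).aestronglyMeasurable measurableSet_Ioi)
      (ae_restrict_of_forall_mem measurableSet_Ioi fun t ht => ?_)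
    rw [Real.norm_of_nonneg (sq_nonneg _)]
    linarith [hE' t (mem_Ici_of_Ioi ht),
      mul_nonneg (by linarith : 0 ≤ γ ^ 2 / 2 - 1) (sq_nonneg ‖u' t‖)]
  have hlim'sq : Tendsto (fun t => ‖u' t‖ ^ 2) atTop (𝓝 0) := by
    refine tendsto_zero_of_hasDerivAt_of_integrableOn_Ioi (a := 0)
      (f' := fun t => 2 * ⟪u' t, u'' t⟫_ℝ)
      (fun t ht => ((hu' t (mem_Ici_of_Ioi ht)).hasDerivAt (Ici_mem_nhds ht)).norm_sq) ?_ hint'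
    refine (hint'.add hint'').mono' (((hu'cont.inner hu''cont).const_smul (2 : ℝ) |>.mono
      Ioi_subset_Ici_self).aestronglyMeasurable measurableSet_Ioi) (ae_of_all _ fun t => ?_)
    rw [norm_mul, Real.norm_ofNat]
    have := norm_inner_le_norm (𝕜 := ℝ) (u' t) (u'' t)
    simp only [Pi.add_apply]
    nlinarith [sq_nonneg (‖u' t‖ - ‖u'' t‖)]
  have hlim' : Tendsto (fun t => ‖u' t‖) atTop (𝓝 0) := by
    simpa [Real.sqrt_sq] using hlim'sq.sqrt
  have hlim'' : Tendsto (fun t => ‖u'' t‖) atTop (𝓝 0) :=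
    tendsto_zero_iff_norm_tendsto_zero.1 (tendsto_deriv_zero_of_lipschitz hu' hlip
      (tendsto_zero_iff_norm_tendsto_zero.2 hlim'))
  have hres : Tendsto (fun t => ‖u t - T (u t)‖) atTop (𝓝 0) := by
    have hsum : Tendsto (fun t => ‖u'' t‖ + γ * ‖u' t‖) atTop (𝓝 0) := by
      simpa using hlim''.add (hlim'.const_mul γ)
    refine squeeze_zero' (Eventually.of_forall fun _ => norm_nonneg _) ?_ hsum
    filter_upwards [eventually_ge_atTop 0] with t ht
    have e : u t - T (u t) = -u'' t - γ • u' t := by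
      rw [hu''eq t ht]
      abel
    rw [e]
    refine (norm_sub_le _ _).trans_eq ?_
    rw [norm_neg, norm_smul, Real.norm_eq_abs, abs_of_pos (by linarith)]
  have hM : ∀ᶠ t in atTop, ‖u t‖ ≤ R + ‖v‖ := by
    filter_upwards [eventually_ge_atTop 0] with t ht
    linarith [norm_le_norm_sub_add (u t) v, (hR t ht).1]
  refine ⟨exists_weak_limit_of_opial hM (fun w hw => ?_) fun U w hU hw =>
    apply_eq_self_of_weak_limit hT (hU hM) hw (hres.mono_left hU), ?_, hlim', hlim''⟩
  · obtain ⟨-, ⟨d, hd⟩, -⟩ := hlyap w hw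
    have hinner : Tendsto (fun t => ⟪u t - w, u' t⟫_ℝ) atTop (𝓝 0) := by
      have hb : Tendsto (fun t => (R + ‖v‖ + ‖w‖) * ‖u' t‖) atTop (𝓝 0) := by
        simpa using hlim'.const_mul (R + ‖v‖ + ‖w‖)
      refine squeeze_zero_norm' ?_ hb
      filter_upwards [hM] with t ht
      refine (norm_inner_le_norm _ _).trans (mul_le_mul_of_nonneg_right ?_ (norm_nonneg _))
      linarith [norm_sub_le (u t) w]
    refine ⟨_, (((hd.sub hinner).sub (hlim'sq.const_mul (γ / 2))).div_const (γ / 2)).congr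
      fun t => ?_⟩
    rw [div_eq_iff (by linarith), dampedEnergy]
    ring
  · exact (integrableOn_Ici_iff_integrableOn_Ioi (by simp)).2 hint'
end
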